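/- In ℤ[q]: h_q(0) = 1, and for all n ≥ 1, h_q(2n−1) = q·h_q(n−1) and h_q(2n) = h_q(n) + q²·h_q(n−1) (with the convention h_q(−1) = 0). -/

import Mathlib

/-- A multiset of naturals is *hyperbinary* if every element is a power of `2`
and no element occurs more than twice. -/
def IsHyperbinary (μ : Multiset ℕ) : Prop :=
  (∀ x ∈ μ, ∃ i : ℕ, x = 2 ^ i) ∧ ∀ x : ℕ, μ.count x ≤ 2

open scoped Classical in
/-- `hq n` is the length generating function `h_q(n) = Σ_{η ∈ H(n)} q^{ℓ(η)}`
over the hyperbinary partitions of `n`, as a polynomial in `ℤ[q]`. -/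
noncomputable def hq (n : ℕ) : Polynomial ℤ :=
  ∑ p ∈ Finset.univ.filter (fun p : n.Partition => IsHyperbinary p.parts),
      (Polynomial.X : Polynomial ℤ) ^ (Multiset.card p.parts)

/-- The multiset obtained from `ν` by doubling every element and adjoining `c` ones. -/
def doubleAddOnes (c : ℕ) (ν : Multiset ℕ) : Multiset ℕ :=
  Multiset.replicate c 1 + ν.map (2 * ·)

theorem card_doubleAddOnes (c : ℕ) (ν : Multiset ℕ) :
    Multiset.card (doubleAddOnes c ν) = c + Multiset.card ν := by
  simp [doubleAddOnes]

theorem sum_doubleAddOnes (c : ℕ) (ν : Multiset ℕ) :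
    (doubleAddOnes c ν).sum = c + 2 * ν.sum := by
  have h : (ν.map (2 * ·)).sum = 2 * ν.sum := by
    simpa using Multiset.sum_map_mul_left (s := ν) (a := 2) (f := id)
  simp [doubleAddOnes, h]

theorem count_one_doubleAddOnes (c : ℕ) (ν : Multiset ℕ) :
    (doubleAddOnes c ν).count 1 = c := by
  simp [doubleAddOnes]

theorem count_two_mul_doubleAddOnes (c : ℕ) (ν : Multiset ℕ) (x : ℕ) :
    (doubleAddOnes c ν).count (2 * x) = ν.count x := by
  have h : (ν.map (2 * ·)).count (2 * x) = ν.count x :=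
    Multiset.count_map_eq_count' (2 * ·) ν (mul_right_injective₀ two_ne_zero) x
  have h1 : (Multiset.replicate c 1).count (2 * x) = 0 := by
    rw [Multiset.count_replicate, if_neg (by omega)]
  rw [doubleAddOnes, Multiset.count_add, h, h1, zero_add]

theorem doubleAddOnes_injective (c : ℕ) : Function.Injective (doubleAddOnes c) := by
  intro ν ν' h
  ext x
  rw [← count_two_mul_doubleAddOnes c, h, count_two_mul_doubleAddOnes]

theorem isHyperbinary_doubleAddOnes {c : ℕ} {ν : Multiset ℕ} :
    IsHyperbinary (doubleAddOnes c ν) ↔ c ≤ 2 ∧ IsHyperbinary ν := by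
  constructor
  · rintro ⟨hpow, hcount⟩
    refine ⟨count_one_doubleAddOnes c ν ▸ hcount 1, fun x hx => ?_,
      fun x => count_two_mul_doubleAddOnes c ν x ▸ hcount (2 * x)⟩
    obtain ⟨i, hi⟩ := hpow (2 * x)
      (Multiset.mem_add.2 (Or.inr (Multiset.mem_map_of_mem _ hx)))
    cases i with
    | zero => omega
    | succ i => exact ⟨i, by rw [pow_succ] at hi; omega⟩
  · rintro ⟨hc, hpow, hcount⟩
    have hmem : ∀ x ∈ doubleAddOnes c ν, x = 1 ∨ ∃ y ∈ ν, 2 * y = x := by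
      intro x hx
      rcases Multiset.mem_add.1 hx with hx | hx
      · exact Or.inl (Multiset.eq_of_mem_replicate hx)
      · exact Or.inr (Multiset.mem_map.1 hx)
    refine ⟨fun x hx => ?_, fun x => ?_⟩
    · rcases hmem x hx with rfl | ⟨y, hy, rfl⟩
      · exact ⟨0, rfl⟩
      · obtain ⟨i, rfl⟩ := hpow y hy
        exact ⟨i + 1, by rw [pow_succ, mul_comm]⟩
    · by_cases hx : x ∈ doubleAddOnes c ν
      · rcases hmem x hx with rfl | ⟨y, -, rfl⟩
        · rwa [count_one_doubleAddOnes]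
        · rw [count_two_mul_doubleAddOnes]
          exact hcount y
      · simp [Multiset.count_eq_zero.2 hx]

theorem IsHyperbinary.exists_eq_doubleAddOnes {μ : Multiset ℕ} (hμ : IsHyperbinary μ) :
    ∃ c ν, c ≤ 2 ∧ IsHyperbinary ν ∧ doubleAddOnes c ν = μ := by
  have h : doubleAddOnes (μ.count 1) ((μ.filter (¬ · = 1)).map (· / 2)) = μ := by
    have hmap : ((μ.filter (¬ · = 1)).map (· / 2)).map (2 * ·) = μ.filter (¬ · = 1) := by
      rw [Multiset.map_map]
      refine (Multiset.map_congr rfl fun x hx => ?_).trans (Multiset.map_id _)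
      obtain ⟨hx, hx1⟩ := Multiset.mem_filter.1 hx
      obtain ⟨i, rfl⟩ := hμ.1 x hx
      cases i with
      | zero => exact absurd rfl hx1
      | succ i => simp [pow_succ, mul_comm]
    rw [doubleAddOnes, hmap, ← Multiset.filter_eq', Multiset.filter_add_not]
  have h' := hμ
  rw [← h, isHyperbinary_doubleAddOnes] at h'
  exact ⟨_, _, h'.1, h'.2, h⟩

open scoped Classical in
/-- The hyperbinary partitions of `n`, as a finset of multisets. -/
noncomputable def hyperbinaryPartitions (n : ℕ) : Finset (Multiset ℕ) :=
  (Finset.univ.filter (fun p : n.Partition => IsHyperbinary p.parts)).image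
    Nat.Partition.parts

theorem mem_hyperbinaryPartitions {n : ℕ} {μ : Multiset ℕ} :
    μ ∈ hyperbinaryPartitions n ↔ IsHyperbinary μ ∧ μ.sum = n := by
  simp only [hyperbinaryPartitions, Finset.mem_image, Finset.mem_filter, Finset.mem_univ,
    true_and]
  constructor
  · rintro ⟨p, hp, rfl⟩
    exact ⟨hp, p.parts_sum⟩
  · rintro ⟨hμ, hsum⟩
    refine ⟨⟨μ, fun {x} hx => ?_, hsum⟩, hμ, rfl⟩
    obtain ⟨i, rfl⟩ := hμ.1 x hx
    positivity

theorem hq_eq_sum_hyperbinaryPartitions (n : ℕ) :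
    hq n = ∑ μ ∈ hyperbinaryPartitions n, (Polynomial.X : Polynomial ℤ) ^ Multiset.card μ := by
  rw [hq, hyperbinaryPartitions, Finset.sum_image]
  exact fun p _ p' _ h => Nat.Partition.ext h

theorem sum_image_doubleAddOnes (c n : ℕ) :
    ∑ μ ∈ (hyperbinaryPartitions n).image (doubleAddOnes c),
      (Polynomial.X : Polynomial ℤ) ^ Multiset.card μ = Polynomial.X ^ c * hq n := by
  rw [Finset.sum_image (doubleAddOnes_injective c).injOn, hq_eq_sum_hyperbinaryPartitions,
    Finset.mul_sum]
  simp only [card_doubleAddOnes, pow_add]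

theorem hyperbinaryPartitions_two_mul_add_one (n : ℕ) :
    hyperbinaryPartitions (2 * n + 1) = (hyperbinaryPartitions n).image (doubleAddOnes 1) := by
  ext μ
  simp only [Finset.mem_image, mem_hyperbinaryPartitions]
  constructor
  · rintro ⟨hμ, hsum⟩
    obtain ⟨c, ν, hc, hν, rfl⟩ := hμ.exists_eq_doubleAddOnes
    rw [sum_doubleAddOnes] at hsum
    obtain rfl : c = 1 := by omega
    exact ⟨ν, ⟨hν, by omega⟩, rfl⟩
  · rintro ⟨ν, ⟨hν, rfl⟩, rfl⟩
    exact ⟨isHyperbinary_doubleAddOnes.2 ⟨by norm_num, hν⟩, by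
      rw [sum_doubleAddOnes, add_comm]⟩

theorem hyperbinaryPartitions_two_mul_add_two (n : ℕ) :
    hyperbinaryPartitions (2 * n + 2) =
      (hyperbinaryPartitions (n + 1)).image (doubleAddOnes 0) ∪
        (hyperbinaryPartitions n).image (doubleAddOnes 2) := by
  ext μ
  simp only [Finset.mem_union, Finset.mem_image, mem_hyperbinaryPartitions]
  constructor
  · rintro ⟨hμ, hsum⟩
    obtain ⟨c, ν, hc, hν, rfl⟩ := hμ.exists_eq_doubleAddOnes
    rw [sum_doubleAddOnes] at hsum
    obtain rfl | rfl : c = 0 ∨ c = 2 := by omega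
    · exact Or.inl ⟨ν, ⟨hν, by omega⟩, rfl⟩
    · exact Or.inr ⟨ν, ⟨hν, by omega⟩, rfl⟩
  · rintro (⟨ν, ⟨hν, hsum⟩, rfl⟩ | ⟨ν, ⟨hν, hsum⟩, rfl⟩)
    all_goals
      exact ⟨isHyperbinary_doubleAddOnes.2 ⟨by norm_num, hν⟩, by
        rw [sum_doubleAddOnes]; omega⟩

theorem hq_zero : hq 0 = 1 := by
  have h : hyperbinaryPartitions 0 = {0} := by
    ext μ
    rw [mem_hyperbinaryPartitions, Finset.mem_singleton]
    constructor
    · rintro ⟨hμ, hsum⟩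
      refine Multiset.eq_zero_of_forall_notMem fun x hx => ?_
      obtain ⟨i, rfl⟩ := hμ.1 x hx
      exact pow_ne_zero i two_ne_zero (Multiset.sum_eq_zero_iff.1 hsum _ hx)
    · rintro rfl
      exact ⟨⟨by simp, by simp⟩, rfl⟩
  simp [hq_eq_sum_hyperbinaryPartitions, h]

theorem hq_two_mul_add_one (n : ℕ) : hq (2 * n + 1) = Polynomial.X * hq n := by
  rw [hq_eq_sum_hyperbinaryPartitions, hyperbinaryPartitions_two_mul_add_one,
    sum_image_doubleAddOnes, pow_one]

theorem hq_two_mul_add_two (n : ℕ) :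
    hq (2 * n + 2) = hq (n + 1) + Polynomial.X ^ 2 * hq n := by
  rw [hq_eq_sum_hyperbinaryPartitions, hyperbinaryPartitions_two_mul_add_two,
    Finset.sum_union, sum_image_doubleAddOnes, sum_image_doubleAddOnes, pow_zero, one_mul]
  rw [Finset.disjoint_left]
  intro μ h0 h2
  obtain ⟨ν, -, rfl⟩ := Finset.mem_image.1 h0
  obtain ⟨ν', -, h⟩ := Finset.mem_image.1 h2
  have := congrArg (Multiset.count 1) h
  simp [count_one_doubleAddOnes] at this

/-- In `ℤ[q]`: `h_q(0) = 1`, and for all `n ≥ 1`, `h_q(2n-1) = q·h_q(n-1)` and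
`h_q(2n) = h_q(n) + q²·h_q(n-1)`. -/
theorem hq_recurrences :
    hq 0 = 1 ∧
    ∀ n : ℕ, 1 ≤ n →
      hq (2 * n - 1) = Polynomial.X * hq (n - 1) ∧
      hq (2 * n) = hq n + Polynomial.X ^ 2 * hq (n - 1) := by
  refine ⟨hq_zero, fun n hn => ?_⟩
  obtain ⟨m, rfl⟩ := Nat.exists_eq_add_of_le' hn
  exact ⟨hq_two_mul_add_one m, hq_two_mul_add_two m⟩
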